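/- Let F be a totally real number field, K/F a CM extension with ker(i_{K/F}) ≠ {1}, and [a] ∈ ker(i_{K/F}) the unique nontrivial class, so that aO_K = λO_K for some λ ∈ K^×. (i) If K ≠ F(√−1), then for an O_F-order B ⊆ O_K one has [a] ∈ ker(i_{B/O_F}) if and only if B contains the O_F-order B₀ := O_F ⊕ I, where I := {z ∈ O_K : z̄ = −z}. (ii) If K = F(√−1), let n be the largest integer with ζ_{2ⁿ} ∈ K, set η := ζ_{2ⁿ} and I_η := {z ∈ O_K : z̄ = ηz}; then [a] ∈ ker(i_{B/O_F}) if and only if B contains the O_F-order B₀ := O_F ⊕ I_η; moreover η ∈ B₀^×, so B₀ is independent of the choice of primitive 2ⁿ-th root of unity. -/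

import Mathlib

/-!
STATEMENT 17: Let `F` be a totally real number field, `K/F` a CM extension with
`ker (i_{K/F}) ≠ {1}`, and `[a] ∈ ker (i_{K/F})` the unique nontrivial class, so that
`a O_K = λ O_K` for some `λ ∈ K^×`.
(i) If `K ≠ F(√−1)`, then for an `O_F`-order `B ⊆ O_K` one has `[a] ∈ ker (i_{B/O_F})` if
and only if `B` contains the `O_F`-order `B₀ := O_F ⊕ I`, where
`I := {z ∈ O_K : z̄ = −z}`.
(ii) If `K = F(√−1)`, let `n` be the largest integer with `ζ_{2ⁿ} ∈ K`, set `η := ζ_{2ⁿ}`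
and `I_η := {z ∈ O_K : z̄ = ηz}`; then `[a] ∈ ker (i_{B/O_F})` if and only if `B` contains
the `O_F`-order `B₀ := O_F ⊕ I_η`; moreover `η ∈ B₀ˣ`, so `B₀` is independent of the
choice of the primitive `2ⁿ`-th root of unity.

Conventions: `z̄` is `σ z` for the nontrivial `F`-automorphism `σ` of `K`;
`B₀` is defined as the subring generated by `O_F` and `I` (resp. `I_η`), and the statement
that `B₀ = O_F ⊕ I` (an order) is expressed by the carrier equality below;
`[a] ∈ ker (i_{B/O_F})` means the extension `aB` is principal; `[a]` is given by an
invertible non-principal fractional `O_F`-ideal.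
-/

noncomputable section
set_option synthInstance.maxHeartbeats 1000000
set_option maxHeartbeats 1000000

/-- `F` is totally real: every complex embedding of `F` is real. -/
def TotReal (F : Type*) [Field F] [NumberField F] : Prop :=
  ∀ φ : F →+* ℂ, NumberField.ComplexEmbedding.IsReal φ

/-- A `ℤ`-order in a `ℚ`-algebra `V`: a subring, finitely generated as a `ℤ`-module,
containing a `ℚ`-basis of `V` (i.e. spanning `V` over `ℚ`). -/
def IsZOrder {V : Type*} [Ring V] [Algebra ℚ V] (O : Subalgebra ℤ V) : Prop :=
  (Subalgebra.toSubmodule O).FG ∧ Submodule.span ℚ (O : Set V) = ⊤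

/-- `x` generates the extension of the invertible fractional ideal `a` to `B`, expressed through
the inclusions `a ⊆ x B` and `a⁻¹ x ⊆ B`. -/
def GeneratesExtension {F K : Type*} [Field F] [Field K] [Algebra F K]
    (a : (Submodule ↥(integralClosure ℤ F) F)ˣ) (B : Subalgebra ℤ K) (x : K) : Prop :=
  (∀ p ∈ (a : Submodule ↥(integralClosure ℤ F) F), algebraMap F K p / x ∈ B) ∧
    ∀ q ∈ ((a⁻¹ : (Submodule ↥(integralClosure ℤ F) F)ˣ) : Submodule ↥(integralClosure ℤ F) F),
      algebraMap F K q * x ∈ B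

theorem one_induction_of_unit {F : Type*} [Field F]
    (a : (Submodule ↥(integralClosure ℤ F) F)ˣ) (P : F → Prop)
    (hmul : ∀ p ∈ (a : Submodule ↥(integralClosure ℤ F) F),
      ∀ q ∈ ((a⁻¹ : (Submodule ↥(integralClosure ℤ F) F)ˣ) :
        Submodule ↥(integralClosure ℤ F) F), P (p * q))
    (hadd : ∀ x y, P x → P y → P (x + y)) : P 1 := by
  have h : (1 : F) ∈ (a : Submodule ↥(integralClosure ℤ F) F) *
      ((a⁻¹ : (Submodule ↥(integralClosure ℤ F) F)ˣ) : Submodule ↥(integralClosure ℤ F) F) := by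
    rw [Units.mul_inv]
    exact Submodule.one_le.mp le_rfl
  exact Submodule.mul_induction_on h hmul hadd

theorem mul_mem_integralClosure_of_unit {F : Type*} [Field F]
    (a : (Submodule ↥(integralClosure ℤ F) F)ˣ) {p q : F}
    (hp : p ∈ (a : Submodule ↥(integralClosure ℤ F) F))
    (hq : q ∈ ((a⁻¹ : (Submodule ↥(integralClosure ℤ F) F)ˣ) :
      Submodule ↥(integralClosure ℤ F) F)) : p * q ∈ integralClosure ℤ F := by
  have h := Submodule.mul_mem_mul hp hq
  rw [Units.mul_inv, Submodule.mem_one] at h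
  obtain ⟨y, hy⟩ := h
  rw [← hy]
  exact y.2

theorem mem_inv_of_mul_mem {F : Type*} [Field F]
    (a : (Submodule ↥(integralClosure ℤ F) F)ˣ) {f : F}
    (hf : ∀ p ∈ (a : Submodule ↥(integralClosure ℤ F) F), f * p ∈ integralClosure ℤ F) :
    f ∈ ((a⁻¹ : (Submodule ↥(integralClosure ℤ F) F)ˣ) :
      Submodule ↥(integralClosure ℤ F) F) := by
  have h := one_induction_of_unit a (fun r => f * r ∈ ((a⁻¹ :
    (Submodule ↥(integralClosure ℤ F) F)ˣ) : Submodule ↥(integralClosure ℤ F) F))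
    (fun p hp q hq => by
      have := Submodule.smul_mem _ (⟨f * p, hf p hp⟩ : ↥(integralClosure ℤ F)) hq
      rwa [Subalgebra.smul_def, smul_eq_mul, mul_assoc] at this)
    (fun x y hx hy => by rw [mul_add]; exact add_mem hx hy)
  simpa using h

theorem algebraMap_mem_integralClosure_iff {F K : Type*} [Field F] [Field K] [Algebra F K]
    {f : F} : algebraMap F K f ∈ integralClosure ℤ K ↔ f ∈ integralClosure ℤ F := by
  rw [mem_integralClosure_iff, mem_integralClosure_iff]
  exact isIntegral_algebraMap_iff (algebraMap F K).injective

theorem AlgEquiv.apply_mem_integralClosure {F K : Type*} [Field F] [Field K] [Algebra F K]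
    (σ : K ≃ₐ[F] K) {z : K} (hz : z ∈ integralClosure ℤ K) : σ z ∈ integralClosure ℤ K :=
  map_isIntegral_int (σ : K →+* K) hz

theorem mem_integralClosure_of_pow_eq_one {K : Type*} [Field K] {u : K} {N : ℕ} (hN : 0 < N)
    (hu : u ^ N = 1) : u ∈ integralClosure ℤ K :=
  IsIntegral.of_pow hN (by rw [hu]; exact isIntegral_one)

theorem span_image_eq_span_singleton_iff {F K : Type*} [Field F] [Field K] [Algebra F K]
    (a : (Submodule ↥(integralClosure ℤ F) F)ˣ) (B : Subalgebra ℤ K)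
    (hB : ∀ f : F, f ∈ integralClosure ℤ F → algebraMap F K f ∈ B) {x : K} (hx : x ≠ 0) :
    Submodule.span ↥B
        (algebraMap F K '' ((a : Submodule ↥(integralClosure ℤ F) F) : Set F))
      = Submodule.span ↥B {x} ↔ GeneratesExtension a B x := by
  constructor
  · intro h
    refine ⟨fun p hp => ?_, fun q hq => ?_⟩
    · have hmem : algebraMap F K p ∈ Submodule.span ↥B {x} := by
        rw [← h]
        exact Submodule.subset_span ⟨p, hp, rfl⟩
      obtain ⟨β, hβ⟩ := Submodule.mem_span_singleton.mp hmem
      rw [← hβ, Subalgebra.smul_def, smul_eq_mul, mul_div_cancel_right₀ _ hx]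
      exact β.2
    · have hmem : x ∈ Submodule.span ↥B
          (algebraMap F K '' ((a : Submodule ↥(integralClosure ℤ F) F) : Set F)) := by
        rw [h]
        exact Submodule.mem_span_singleton_self x
      refine Submodule.span_induction (p := fun y _ => algebraMap F K q * y ∈ B)
        ?_ ?_ ?_ ?_ hmem
      · rintro _ ⟨p, hp, rfl⟩
        rw [← map_mul, mul_comm]
        exact hB _ (mul_mem_integralClosure_of_unit a hp hq)
      · simp
      · intro y z _ _ hy hz
        rw [mul_add]
        exact add_mem hy hz
      · intro β y _ hy
        rw [Subalgebra.smul_def, smul_eq_mul, mul_left_comm]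
        exact mul_mem β.2 hy
  · rintro ⟨h1, h2⟩
    apply le_antisymm
    · rw [Submodule.span_le]
      rintro _ ⟨p, hp, rfl⟩
      refine Submodule.mem_span_singleton.mpr ⟨⟨_, h1 p hp⟩, ?_⟩
      rw [Subalgebra.smul_def, smul_eq_mul]
      exact div_mul_cancel₀ _ hx
    · rw [Submodule.span_le, Set.singleton_subset_iff]
      have h := one_induction_of_unit a (fun r => algebraMap F K r * x ∈ Submodule.span ↥B
        (algebraMap F K '' ((a : Submodule ↥(integralClosure ℤ F) F) : Set F)))
        (fun p hp q hq => by
          have := Submodule.smul_mem (Submodule.span ↥B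
            (algebraMap F K '' ((a : Submodule ↥(integralClosure ℤ F) F) : Set F)))
            (⟨_, h2 q hq⟩ : ↥B) (Submodule.subset_span ⟨p, hp, rfl⟩)
          rw [Subalgebra.smul_def, smul_eq_mul] at this
          convert this using 1
          rw [map_mul]
          ring)
        (fun y z hy hz => by rw [map_add, add_mul]; exact add_mem hy hz)
      simpa using h

theorem GeneratesExtension.mono {F K : Type*} [Field F] [Field K] [Algebra F K]
    {a : (Submodule ↥(integralClosure ℤ F) F)ˣ} {B C : Subalgebra ℤ K} {x : K}
    (h : GeneratesExtension a B x) (hBC : B ≤ C) : GeneratesExtension a C x :=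
  ⟨fun p hp => hBC (h.1 p hp), fun q hq => hBC (h.2 q hq)⟩

theorem GeneratesExtension.mul {F K : Type*} [Field F] [Field K] [Algebra F K]
    {a : (Submodule ↥(integralClosure ℤ F) F)ˣ} {B : Subalgebra ℤ K} {x u : K}
    (h : GeneratesExtension a B x) (hu : u ∈ B) (hu' : u⁻¹ ∈ B) :
    GeneratesExtension a B (x * u) := by
  refine ⟨fun p hp => ?_, fun q hq => ?_⟩
  · rw [← div_div, div_eq_mul_inv _ u]
    exact mul_mem (h.1 p hp) hu'
  · rw [← mul_assoc]
    exact mul_mem (h.2 q hq) hu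

theorem GeneratesExtension.map {F K : Type*} [Field F] [Field K] [Algebra F K]
    {a : (Submodule ↥(integralClosure ℤ F) F)ˣ} {B : Subalgebra ℤ K} {x : K}
    (h : GeneratesExtension a B x) (σ : K ≃ₐ[F] K) (hσ : ∀ z ∈ B, σ z ∈ B) :
    GeneratesExtension a B (σ x) := by
  refine ⟨fun p hp => ?_, fun q hq => ?_⟩
  · simpa using hσ _ (h.1 p hp)
  · simpa using hσ _ (h.2 q hq)

theorem GeneratesExtension.div_mem {F K : Type*} [Field F] [Field K] [Algebra F K]
    {a : (Submodule ↥(integralClosure ℤ F) F)ˣ} {B : Subalgebra ℤ K} {x y : K}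
    (hx : GeneratesExtension a B x) (hy : GeneratesExtension a B y) : y / x ∈ B := by
  have h := one_induction_of_unit a (fun r => algebraMap F K r * (y / x) ∈ B)
    (fun p hp q hq => by
      convert mul_mem (hx.1 p hp) (hy.2 q hq) using 1
      rw [map_mul]
      ring)
    (fun r s hr hs => by rw [map_add, add_mul]; exact add_mem hr hs)
  simpa using h

theorem GeneratesExtension.eq_span_singleton {F K : Type*} [Field F] [Field K] [Algebra F K]
    {a : (Submodule ↥(integralClosure ℤ F) F)ˣ} {f : F} (hf : f ≠ 0)
    (h : GeneratesExtension a (integralClosure ℤ K) (algebraMap F K f)) :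
    (a : Submodule ↥(integralClosure ℤ F) F) = Submodule.span ↥(integralClosure ℤ F) {f} := by
  have h' : GeneratesExtension (K := F) a (integralClosure ℤ F) f := by
    refine ⟨fun p hp => ?_, fun q hq => ?_⟩
    · rw [← algebraMap_mem_integralClosure_iff (K := K)]
      simpa using h.1 p hp
    · rw [← algebraMap_mem_integralClosure_iff (K := K)]
      simpa using h.2 q hq
  rw [← (span_image_eq_span_singleton_iff a (integralClosure ℤ F) (fun _ => id) hf).mpr h']
  simp

/-- A root of unity `u` is, up to squares of roots of unity, either `1` or the generator `η` of the
`2`-power roots of unity; in the latter case the square root may be taken among powers of `u`. -/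
theorem exists_sq_or_exists_pow_sq_of_pow_eq_one {K : Type*} [Field K] {n : ℕ} {η u : K}
    (hη : IsPrimitiveRoot η (2 ^ n)) (hn : ¬ ∃ ξ : K, IsPrimitiveRoot ξ (2 ^ (n + 1)))
    {N : ℕ} (hN : 0 < N) (hu : u ^ N = 1) :
    (∃ θ : K, ∃ M : ℕ, 0 < M ∧ θ ^ M = 1 ∧ u = θ ^ 2) ∨ ∃ k : ℕ, u = η * (u ^ k) ^ 2 := by
  have hfin : IsOfFinOrder u := isOfFinOrder_iff_pow_eq_one.mpr ⟨N, hN, hu⟩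
  have hpos : 0 < orderOf u := hfin.orderOf_pos
  have hu0 : u ≠ 0 := by
    rintro rfl
    rw [zero_pow hN.ne'] at hu
    exact zero_ne_one hu
  obtain ⟨k, m, hm, hkm⟩ := Nat.exists_eq_two_pow_mul_odd hpos.ne'
  have hprim : IsPrimitiveRoot (u ^ m) (2 ^ k) := by
    refine (IsPrimitiveRoot.orderOf u).pow hpos ?_
    rw [hkm, mul_comm]
  have hk : k ≤ n := by
    by_contra hlt
    push Not at hlt
    refine hn ⟨(u ^ m) ^ 2 ^ (k - (n + 1)), hprim.pow (by positivity) ?_⟩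
    rw [← pow_add]
    congr 1
    omega
  have hum : (u ^ m) ^ 2 ^ n = 1 := by
    obtain ⟨c, hc⟩ := pow_dvd_pow 2 hk
    rw [hc, pow_mul, hprim.pow_eq_one, one_pow]
  obtain ⟨j, -, hj⟩ := hη.eq_pow_of_pow_eq_one hum
  obtain ⟨s, hs⟩ := hm
  have hord : u ^ orderOf u = 1 := pow_orderOf_eq_one u
  -- `u ^ (orderOf u - 1)` serves as the inverse of `u`
  set w := u ^ (orderOf u - 1) with hw
  have huw : u * w = 1 := by
    rw [hw, ← pow_succ', Nat.sub_add_cancel hpos, hord]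
  have huj : u = η ^ j * (w ^ s) ^ 2 := by
    have h1 : (u * w) ^ (2 * s) = 1 := by rw [huw, one_pow]
    calc u = u * (u * w) ^ (2 * s) := by rw [h1, mul_one]
      _ = u ^ (2 * s + 1) * (w ^ s) ^ 2 := by ring
      _ = _ := by rw [← hs, hj]
  rcases Nat.even_or_odd' j with ⟨t, rfl | rfl⟩
  · left
    refine ⟨η ^ t * w ^ s, 2 ^ n * orderOf u, by positivity, ?_, ?_⟩
    · rw [mul_pow, ← pow_mul, ← pow_mul, hw, ← pow_mul,
        show t * (2 ^ n * orderOf u) = 2 ^ n * (t * orderOf u) by ring, pow_mul, hη.pow_eq_one,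
        show (orderOf u - 1) * (s * (2 ^ n * orderOf u))
          = orderOf u * ((orderOf u - 1) * (s * 2 ^ n)) by ring, pow_mul u, hord]
      simp
    · rw [mul_pow, ← pow_mul η, mul_comm t 2]
      exact huj
  · right
    have hprim' : IsPrimitiveRoot (u ^ m) (2 ^ n) := by
      rw [← hj]
      exact hη.pow_of_coprime _ (Nat.Coprime.pow_right _ (by simp))
    obtain ⟨i, -, hi⟩ := hprim'.eq_pow_of_pow_eq_one hη.pow_eq_one
    refine ⟨m * i * t + (orderOf u - 1) * s, ?_⟩
    calc u = η ^ (2 * t + 1) * (w ^ s) ^ 2 := huj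
      _ = η * (η ^ t * w ^ s) ^ 2 := by ring
      _ = _ := by
        congr 2
        rw [← hi, hw]
        ring

/-- The ring `O_F ⊕ I_ε` with `I_ε = {z ∈ O_K : σ z = ε z}`. -/
theorem coe_adjoin_eigenspace {F K : Type*} [Field F] [Field K] [Algebra F K]
    (σ : K ≃ₐ[F] K) (hfix : ∀ z : K, σ z = z → ∃ f : F, algebraMap F K f = z)
    {ε : K} (hε0 : ε ≠ 0) (hε : ε ∈ integralClosure ℤ K) (hσε : σ ε = ε⁻¹) :
    ((Algebra.adjoin ℤ ((algebraMap F K '' (integralClosure ℤ F : Set F)) ∪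
        {z : K | z ∈ integralClosure ℤ K ∧ σ z = ε * z}) : Set K)
      = {x : K | ∃ f ∈ integralClosure ℤ F,
          ∃ z ∈ {z : K | z ∈ integralClosure ℤ K ∧ σ z = ε * z}, x = algebraMap F K f + z}) := by
  have hε' : ε⁻¹ ∈ integralClosure ℤ K := hσε ▸ σ.apply_mem_integralClosure hε
  apply Set.Subset.antisymm
  · intro x hx
    refine Algebra.adjoin_induction (p := fun x _ => ∃ f ∈ integralClosure ℤ F,
          ∃ z ∈ {z : K | z ∈ integralClosure ℤ K ∧ σ z = ε * z}, x = algebraMap F K f + z)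
      ?_ ?_ ?_ ?_ hx
    · rintro _ (⟨f, hf, rfl⟩ | hz)
      · exact ⟨f, hf, 0, ⟨zero_mem _, by simp⟩, by simp⟩
      · exact ⟨0, zero_mem _, _, hz, by simp⟩
    · intro r
      exact ⟨algebraMap ℤ F r, Subalgebra.algebraMap_mem _ _, 0, ⟨zero_mem _, by simp⟩, by simp⟩
    · rintro _ _ _ _ ⟨f, hf, z, ⟨hz, hz'⟩, rfl⟩ ⟨g, hg, w, ⟨hw, hw'⟩, rfl⟩
      refine ⟨f + g, add_mem hf hg, z + w, ⟨add_mem hz hw, ?_⟩, ?_⟩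
      · rw [map_add, hz', hw', mul_add]
      · rw [map_add]
        ring
    · rintro _ _ _ _ ⟨f, hf, z, ⟨hz, hz'⟩, rfl⟩ ⟨g, hg, w, ⟨hw, hw'⟩, rfl⟩
      obtain ⟨c, hc⟩ := hfix (ε * (z * w)) (by
        rw [map_mul, map_mul, hσε, hz', hw']
        field_simp)
      have hcO : c ∈ integralClosure ℤ F := by
        rw [← algebraMap_mem_integralClosure_iff (K := K), hc]
        exact mul_mem hε (mul_mem hz hw)
      have hfO := (algebraMap_mem_integralClosure_iff (K := K)).mpr hf
      have hgO := (algebraMap_mem_integralClosure_iff (K := K)).mpr hg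
      have hcO' := (algebraMap_mem_integralClosure_iff (K := K)).mpr hcO
      refine ⟨f * g - c, sub_mem (mul_mem hf hg) hcO,
        algebraMap F K f * w + algebraMap F K g * z + algebraMap F K c * (1 + ε⁻¹),
        ⟨add_mem (add_mem (mul_mem hfO hw) (mul_mem hgO hz))
          (mul_mem hcO' (add_mem (one_mem _) hε')), ?_⟩, ?_⟩
      · simp only [map_add, map_mul, AlgEquiv.commutes, hz', hw', map_one, map_inv₀, hσε]
        field_simp
        ring
      · have : z * w = algebraMap F K c * ε⁻¹ := by
          rw [hc]
          field_simp
        rw [map_sub, map_mul]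
        linear_combination this
  · rintro _ ⟨f, hf, z, hz, rfl⟩
    exact add_mem (Algebra.subset_adjoin (Or.inl ⟨f, hf, rfl⟩))
      (Algebra.subset_adjoin (Or.inr hz))

theorem unit_mem_adjoin_eigenspace {F K : Type*} [Field F] [Field K] [Algebra F K]
    (σ : K ≃ₐ[F] K) (hfix : ∀ z : K, σ z = z → ∃ f : F, algebraMap F K f = z)
    {ε : K} (hε0 : ε ≠ 0) (hε : ε ∈ integralClosure ℤ K) (hσε : σ ε = ε⁻¹) :
    ε ∈ Algebra.adjoin ℤ ((algebraMap F K '' (integralClosure ℤ F : Set F)) ∪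
        {z : K | z ∈ integralClosure ℤ K ∧ σ z = ε * z}) ∧
      ε⁻¹ ∈ Algebra.adjoin ℤ ((algebraMap F K '' (integralClosure ℤ F : Set F)) ∪
        {z : K | z ∈ integralClosure ℤ K ∧ σ z = ε * z}) := by
  have hε' : ε⁻¹ ∈ integralClosure ℤ K := hσε ▸ σ.apply_mem_integralClosure hε
  obtain ⟨c, hc⟩ := hfix (ε + ε⁻¹) (by rw [map_add, map_inv₀, hσε, inv_inv, add_comm])
  have hcO : c ∈ integralClosure ℤ F := by
    rw [← algebraMap_mem_integralClosure_iff (K := K), hc]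
    exact add_mem hε hε'
  have hinv : ε⁻¹ ∈ Algebra.adjoin ℤ ((algebraMap F K '' (integralClosure ℤ F : Set F)) ∪
        {z : K | z ∈ integralClosure ℤ K ∧ σ z = ε * z}) := by
    have h : 1 + ε⁻¹ ∈ Algebra.adjoin ℤ ((algebraMap F K '' (integralClosure ℤ F : Set F)) ∪
        {z : K | z ∈ integralClosure ℤ K ∧ σ z = ε * z}) := by
      refine Algebra.subset_adjoin (Or.inr ⟨add_mem (one_mem _) hε', ?_⟩)
      rw [map_add, map_one, map_inv₀, hσε]
      field_simp
      ring
    simpa using sub_mem h (one_mem _)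
  refine ⟨?_, hinv⟩
  have h : algebraMap F K c ∈ Algebra.adjoin ℤ
      ((algebraMap F K '' (integralClosure ℤ F : Set F)) ∪
        {z : K | z ∈ integralClosure ℤ K ∧ σ z = ε * z}) :=
    Algebra.subset_adjoin (Or.inl ⟨c, hcO, rfl⟩)
  rw [hc] at h
  simpa using sub_mem h hinv

theorem adjoin_eigenspace_le_integralClosure {F K : Type*} [Field F] [Field K] [Algebra F K]
    (σ : K ≃ₐ[F] K) (ε : K) :
    Algebra.adjoin ℤ ((algebraMap F K '' (integralClosure ℤ F : Set F)) ∪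
        {z : K | z ∈ integralClosure ℤ K ∧ σ z = ε * z}) ≤ integralClosure ℤ K := by
  rw [Algebra.adjoin_le_iff]
  rintro _ (⟨f, hf, rfl⟩ | hz)
  · exact algebraMap_mem_integralClosure_iff.mpr hf
  · exact hz.1

theorem adjoin_eigenspace_mul_sq_le {F K : Type*} [Field F] [Field K] [Algebra F K]
    (σ : K ≃ₐ[F] K) (hfix : ∀ z : K, σ z = z → ∃ f : F, algebraMap F K f = z)
    {ε : K} (hε0 : ε ≠ 0) (hε : ε ∈ integralClosure ℤ K) (hσε : σ ε = ε⁻¹) (s : ℕ) :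
    Algebra.adjoin ℤ ((algebraMap F K '' (integralClosure ℤ F : Set F)) ∪
        {z : K | z ∈ integralClosure ℤ K ∧ σ z = ε ^ (2 * s + 1) * z}) ≤
      Algebra.adjoin ℤ ((algebraMap F K '' (integralClosure ℤ F : Set F)) ∪
        {z : K | z ∈ integralClosure ℤ K ∧ σ z = ε * z}) := by
  rw [Algebra.adjoin_le_iff]
  rintro z (⟨f, hf, rfl⟩ | ⟨hz, hz'⟩)
  · exact Algebra.subset_adjoin (Or.inl ⟨f, hf, rfl⟩)
  · have hw : z * ε ^ s ∈ Algebra.adjoin ℤ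
        ((algebraMap F K '' (integralClosure ℤ F : Set F)) ∪
          {z : K | z ∈ integralClosure ℤ K ∧ σ z = ε * z}) := by
      refine Algebra.subset_adjoin (Or.inr ⟨mul_mem hz (pow_mem hε s), ?_⟩)
      rw [map_mul, map_pow, hσε, hz', inv_pow]
      field_simp
      ring
    have h := mul_mem hw (pow_mem (unit_mem_adjoin_eigenspace σ hfix hε0 hε hσε).2 s)
    rw [mul_assoc, ← mul_pow, mul_inv_cancel₀ hε0, one_pow, mul_one] at h
    exact h

theorem isZOrder_of_le_of_span {K : Type*} [Field K] [NumberField K] {O : Subalgebra ℤ K}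
    (hO : O ≤ integralClosure ℤ K) (hspan : Submodule.span ℚ (O : Set K) = ⊤) : IsZOrder O := by
  refine ⟨?_, hspan⟩
  have hnoeth : IsNoetherian ℤ ↥(Subalgebra.toSubmodule (integralClosure ℤ K)) :=
    inferInstanceAs (IsNoetherian ℤ (NumberField.RingOfIntegers K))
  rw [isNoetherian_submodule] at hnoeth
  exact hnoeth _ hO

theorem exists_int_mul_mem_integralClosure {K : Type*} [Field K] [NumberField K] (x : K) :
    ∃ d : ℤ, d ≠ 0 ∧ (d : K) * x ∈ integralClosure ℤ K := by
  have hx : IsAlgebraic ℤ x :=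
    (IsFractionRing.isAlgebraic_iff ℤ ℚ K).mpr (Algebra.IsAlgebraic.isAlgebraic x)
  obtain ⟨d, hd, h⟩ := hx.exists_integral_multiple
  exact ⟨d, hd, by simpa [mem_integralClosure_iff] using h⟩

theorem isZOrder_adjoin_eigenspace {F K : Type*} [Field F] [NumberField F] [Field K]
    [NumberField K] [Algebra F K] (σ : K ≃ₐ[F] K) (hσσ : ∀ z, σ (σ z) = z)
    (hfix : ∀ z : K, σ z = z → ∃ f : F, algebraMap F K f = z)
    {ε : K} (hε0 : ε ≠ 0) (hε1 : ε ≠ 1) (hσε : σ ε = ε⁻¹)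
    {L : K} (hL0 : L ≠ 0) (hL : σ L = ε * L) :
    IsZOrder (Algebra.adjoin ℤ ((algebraMap F K '' (integralClosure ℤ F : Set F)) ∪
        {z : K | z ∈ integralClosure ℤ K ∧ σ z = ε * z})) := by
  refine isZOrder_of_le_of_span (adjoin_eigenspace_le_integralClosure σ ε) ?_
  rw [eq_top_iff]
  intro y _
  have hε1' : ε - 1 ≠ 0 := sub_ne_zero.mpr hε1
  have hε1'' : 1 - ε ≠ 0 := sub_ne_zero.mpr hε1.symm
  obtain ⟨g, hg⟩ := hfix ((σ y - y) / (L * (ε - 1))) (by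
    rw [map_div₀, map_sub, map_mul, map_sub, hσσ, hL, hσε, map_one]
    field_simp
    ring)
  obtain ⟨f, hf⟩ := hfix (y - algebraMap F K g * L) (by
    rw [map_sub, map_mul, AlgEquiv.commutes, hL, hg]
    field_simp
    ring)
  have hy : y = algebraMap F K f + algebraMap F K g * L := by
    rw [hf]
    ring
  have hclear : ∀ z : K, ∀ d : ℤ, d ≠ 0 → (d : K) * z ∈ Algebra.adjoin ℤ
      ((algebraMap F K '' (integralClosure ℤ F : Set F)) ∪
        {z : K | z ∈ integralClosure ℤ K ∧ σ z = ε * z}) →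
      z ∈ Submodule.span ℚ ((Algebra.adjoin ℤ
        ((algebraMap F K '' (integralClosure ℤ F : Set F)) ∪
          {z : K | z ∈ integralClosure ℤ K ∧ σ z = ε * z}) : Subalgebra ℤ K) : Set K) := by
    intro z d hd hz
    have h := Submodule.smul_mem _ ((d : ℚ)⁻¹) (Submodule.subset_span (R := ℚ) hz)
    have hdK : (d : K) ≠ 0 := Int.cast_ne_zero.mpr hd
    rw [Algebra.smul_def, map_inv₀, map_intCast, inv_mul_cancel_left₀ hdK] at h
    exact h
  rw [hy]
  refine add_mem ?_ ?_
  · obtain ⟨d, hd, h⟩ := exists_int_mul_mem_integralClosure f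
    refine hclear _ d hd (Algebra.subset_adjoin (Or.inl ⟨_, h, ?_⟩))
    rw [map_mul, map_intCast]
  · obtain ⟨d, hd, h⟩ := exists_int_mul_mem_integralClosure (algebraMap F K g * L)
    refine hclear _ d hd (Algebra.subset_adjoin (Or.inr ⟨h, ?_⟩))
    rw [map_mul, map_mul, map_intCast, AlgEquiv.commutes, hL]
    ring

theorem exists_algebraMap_eq_of_apply_eq {F K : Type*} [Field F] [Field K] [Algebra F K]
    (hquad : Module.finrank F K = 2) (σ : K ≃ₐ[F] K) (hσ : σ ≠ AlgEquiv.refl) {z : K}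
    (hz : σ z = z) : ∃ f : F, algebraMap F K f = z := by
  have : FiniteDimensional F K := Module.finite_of_finrank_eq_succ hquad
  have hprime : (Module.finrank F K).Prime := hquad ▸ Nat.prime_two
  have := IntermediateField.isSimpleOrder_of_finrank_prime F K hprime
  rcases eq_bot_or_eq_top (IntermediateField.adjoin F {z}) with h | h
  · exact IntermediateField.mem_bot.mp (IntermediateField.adjoin_simple_eq_bot_iff.mp h)
  · refine absurd ?_ hσ
    ext w
    have hw : w ∈ IntermediateField.adjoin F {z} := h ▸ IntermediateField.mem_top
    refine IntermediateField.adjoin_induction F (p := fun w _ => σ w = AlgEquiv.refl w)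
      ?_ ?_ ?_ ?_ ?_ hw
    · rintro _ rfl
      exact hz
    · intro f
      simp
    · intro x y _ _ hx hy
      simpa using congrArg₂ (· + ·) hx hy
    · intro x _ hx
      simpa using hx
    · intro x y _ _ hx hy
      simpa using congrArg₂ (· * ·) hx hy

theorem card_aut_eq_two_of_ne_refl {F K : Type*} [Field F] [Field K] [Algebra F K]
    (hquad : Module.finrank F K = 2) (σ : K ≃ₐ[F] K) (hσ : σ ≠ AlgEquiv.refl) :
    Nat.card (K ≃ₐ[F] K) = 2 := by
  have : FiniteDimensional F K := Module.finite_of_finrank_eq_succ hquad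
  have h1 : Nat.card (K ≃ₐ[F] K) ≤ 2 := by
    rw [Nat.card_eq_fintype_card]
    exact hquad ▸ AlgEquiv.card_le
  have h2 : 1 < Nat.card (K ≃ₐ[F] K) := by
    rw [Finite.one_lt_card_iff_nontrivial]
    exact ⟨σ, AlgEquiv.refl, hσ⟩
  omega

theorem eq_refl_or_eq_of_ne_refl {F K : Type*} [Field F] [Field K] [Algebra F K]
    (hquad : Module.finrank F K = 2) (σ : K ≃ₐ[F] K) (hσ : σ ≠ AlgEquiv.refl) (τ : K ≃ₐ[F] K) :
    τ = AlgEquiv.refl ∨ τ = σ := by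
  have hcard := card_aut_eq_two_of_ne_refl hquad σ hσ
  obtain ⟨x, -, hx⟩ := (Nat.card_eq_two_iff' (AlgEquiv.refl : K ≃ₐ[F] K)).mp hcard
  by_cases h : τ = AlgEquiv.refl
  · exact Or.inl h
  · exact Or.inr ((hx τ h).trans (hx σ hσ).symm)

theorem embedding_apply_eq_conj {F K : Type*} [Field F] [NumberField F] (hF : TotReal F)
    [Field K] [Algebra F K] (hquad : Module.finrank F K = 2) (hCM : IsEmpty (K →+* ℝ))
    (σ : K ≃ₐ[F] K) (hσ : σ ≠ AlgEquiv.refl) (φ : K →+* ℂ) (z : K) :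
    φ (σ z) = starRingEnd ℂ (φ z) := by
  have : FiniteDimensional F K := Module.finite_of_finrank_eq_succ hquad
  have : IsGalois F K := by
    refine IsGalois.of_card_aut_eq_finrank F K ?_
    rw [card_aut_eq_two_of_ne_refl hquad σ hσ, hquad]
  obtain ⟨τ, hτ⟩ := NumberField.ComplexEmbedding.exists_comp_symm_eq_of_comp_eq (k := F) φ
    (NumberField.ComplexEmbedding.conjugate φ) (by
      ext f
      exact (RingHom.congr_fun (hF (φ.comp (algebraMap F K))) f).symm)
  have hval : ∀ w, φ (τ.symm w) = starRingEnd ℂ (φ w) := fun w => RingHom.congr_fun hτ w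
  rcases eq_refl_or_eq_of_ne_refl hquad σ hσ τ.symm with h | h
  · have hreal : NumberField.ComplexEmbedding.IsReal φ := by
      ext w
      have := hval w
      rw [h] at this
      exact this.symm
    exact (hCM.false hreal.embedding).elim
  · rw [← h]
    exact hval z

section ComplexConjugation

variable {F K : Type*} [Field F] [Field K] [NumberField K] [Algebra F K] {σ : K ≃ₐ[F] K}

theorem apply_eq_inv_of_pow_eq_one (hconj : ∀ (φ : K →+* ℂ) z, φ (σ z) = starRingEnd ℂ (φ z))
    {u : K} {N : ℕ} (hN : 0 < N) (hu : u ^ N = 1) : σ u = u⁻¹ := by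
  obtain ⟨φ⟩ : Nonempty (K →+* ℂ) := inferInstance
  apply φ.injective
  have h : ‖φ u‖ = 1 :=
    Complex.norm_eq_one_of_pow_eq_one (by rw [← map_pow, hu, map_one]) hN.ne'
  rw [hconj, map_inv₀, Complex.inv_eq_conj h]

theorem exists_pow_eq_one_of_mul_apply_eq_one
    (hconj : ∀ (φ : K →+* ℂ) z, φ (σ z) = starRingEnd ℂ (φ z))
    {u : K} (hu : u ∈ integralClosure ℤ K) (h : u * σ u = 1) : ∃ N : ℕ, 0 < N ∧ u ^ N = 1 := by
  obtain ⟨N, hN, hN'⟩ := NumberField.Embeddings.pow_eq_one_of_norm_eq_one K ℂ hu (fun φ => by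
    have h1 : φ u * starRingEnd ℂ (φ u) = 1 := by rw [← hconj, ← map_mul, h, map_one]
    rw [Complex.mul_conj, Complex.normSq_eq_norm_sq] at h1
    have h2 : ‖φ u‖ ^ 2 = 1 := by exact_mod_cast h1
    exact (pow_eq_one_iff_of_nonneg (norm_nonneg _) two_ne_zero).mp h2)
  exact ⟨N, hN, hN'⟩

theorem exists_generator_eigenvector
    (hconj : ∀ (φ : K →+* ℂ) z, φ (σ z) = starRingEnd ℂ (φ z)) (hσσ : ∀ z, σ (σ z) = z)
    (hfix : ∀ z : K, σ z = z → ∃ f : F, algebraMap F K f = z)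
    {a : (Submodule ↥(integralClosure ℤ F) F)ˣ}
    (hnp : ¬ ∃ x : F, x ≠ 0 ∧ (a : Submodule ↥(integralClosure ℤ F) F)
      = Submodule.span ↥(integralClosure ℤ F) {x})
    {n : ℕ} {η : K} (hη : IsPrimitiveRoot η (2 ^ n))
    (hn : ¬ ∃ ξ : K, IsPrimitiveRoot ξ (2 ^ (n + 1)))
    {B : Subalgebra ℤ K} (hBO : B ≤ integralClosure ℤ K)
    (hB : ∀ f : F, f ∈ integralClosure ℤ F → algebraMap F K f ∈ B)
    {x : K} (hx0 : x ≠ 0) (hx : GeneratesExtension a B x) :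
    ∃ y : K, y ≠ 0 ∧ σ y = η * y ∧ GeneratesExtension a B y := by
  have hσB : ∀ z ∈ B, σ z ∈ B := by
    intro z hz
    obtain ⟨t, ht⟩ := hfix (z + σ z) (by rw [map_add, hσσ, add_comm])
    have htO : t ∈ integralClosure ℤ F := by
      rw [← algebraMap_mem_integralClosure_iff (K := K), ht]
      exact add_mem (hBO hz) (σ.apply_mem_integralClosure (hBO hz))
    have h := sub_mem (hB t htO) hz
    rw [ht] at h
    simpa using h
  have hσx0 : σ x ≠ 0 := by simpa using hx0
  have hu : σ x / x ∈ B := hx.div_mem (hx.map σ hσB)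
  obtain ⟨N, hN, huN⟩ := exists_pow_eq_one_of_mul_apply_eq_one hconj (hBO hu) (by
    rw [map_div₀, hσσ]
    field_simp)
  have hσx : σ x = σ x / x * x := by field_simp
  generalize σ x / x = u at hu huN hσx
  rcases exists_sq_or_exists_pow_sq_of_pow_eq_one hη hn hN huN with
    ⟨θ, M, hM, hθ, rfl⟩ | ⟨k, hk⟩
  · have hθ0 : θ ≠ 0 := by
      rintro rfl
      rw [zero_pow hM.ne'] at hθ
      exact zero_ne_one hθ
    have hσθ := apply_eq_inv_of_pow_eq_one hconj hM hθ
    obtain ⟨f, hf⟩ := hfix (x * θ) (by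
      rw [map_mul, hσx, hσθ]
      field_simp)
    have hgen : GeneratesExtension a (integralClosure ℤ K) (algebraMap F K f) := by
      rw [hf]
      exact (hx.mono hBO).mul (mem_integralClosure_of_pow_eq_one hM hθ)
        (mem_integralClosure_of_pow_eq_one hM (by rw [inv_pow, hθ, inv_one]))
    refine absurd ⟨f, ?_, hgen.eq_span_singleton ?_⟩ hnp <;>
    · rintro rfl
      rw [map_zero] at hf
      exact mul_ne_zero hx0 hθ0 hf.symm
  · have hu0 : u ≠ 0 := by
      rintro rfl
      rw [zero_pow hN.ne'] at huN
      exact zero_ne_one huN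
    have hσu := apply_eq_inv_of_pow_eq_one hconj hN huN
    refine ⟨x * u ^ k, mul_ne_zero hx0 (pow_ne_zero _ hu0), ?_, hx.mul (pow_mem hu k) ?_⟩
    · have h : u ^ k * u⁻¹ ^ k = 1 := by rw [← mul_pow, mul_inv_cancel₀ hu0, one_pow]
      rw [map_mul, map_pow, hσx, hσu]
      generalize u ^ k = v at hk h
      generalize u⁻¹ ^ k = w at h
      linear_combination x * w * hk + η * x * v * h
    · rw [← inv_pow, ← hσu]
      exact pow_mem (hσB u hu) k

theorem exists_mem_inv_of_mem_eigenspace (hfix : ∀ z : K, σ z = z → ∃ f : F, algebraMap F K f = z)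
    {a : (Submodule ↥(integralClosure ℤ F) F)ˣ} {ε y : K} (hε0 : ε ≠ 0) (hy0 : y ≠ 0)
    (hy : σ y = ε * y) (hgen : GeneratesExtension a (integralClosure ℤ K) y)
    {z : K} (hzO : z ∈ integralClosure ℤ K) (hz : σ z = ε * z) :
    ∃ q ∈ ((a⁻¹ : (Submodule ↥(integralClosure ℤ F) F)ˣ) : Submodule ↥(integralClosure ℤ F) F),
      z = algebraMap F K q * y := by
  obtain ⟨f, hf⟩ := hfix (z / y) (by rw [map_div₀, hy, hz]; field_simp)
  refine ⟨f, mem_inv_of_mul_mem a fun p hp => ?_, by rw [hf]; field_simp⟩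
  rw [← algebraMap_mem_integralClosure_iff (K := K), map_mul, hf]
  convert mul_mem hzO (hgen.1 p hp) using 1
  ring

theorem exists_generator_iff_adjoin_eigenspace_le
    (hconj : ∀ (φ : K →+* ℂ) z, φ (σ z) = starRingEnd ℂ (φ z)) (hσσ : ∀ z, σ (σ z) = z)
    (hfix : ∀ z : K, σ z = z → ∃ f : F, algebraMap F K f = z)
    {a : (Submodule ↥(integralClosure ℤ F) F)ˣ}
    (hnp : ¬ ∃ x : F, x ≠ 0 ∧ (a : Submodule ↥(integralClosure ℤ F) F)
      = Submodule.span ↥(integralClosure ℤ F) {x})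
    {n : ℕ} {η : K} (hη : IsPrimitiveRoot η (2 ^ n))
    (hn : ¬ ∃ ξ : K, IsPrimitiveRoot ξ (2 ^ (n + 1)))
    {L : K} (hL0 : L ≠ 0) (hL : σ L = η * L)
    (hgen : GeneratesExtension a (integralClosure ℤ K) L)
    {B : Subalgebra ℤ K} (hBO : B ≤ integralClosure ℤ K)
    (hB : ∀ f : F, f ∈ integralClosure ℤ F → algebraMap F K f ∈ B) :
    (∃ x : K, x ≠ 0 ∧ Submodule.span ↥B
        (algebraMap F K '' ((a : Submodule ↥(integralClosure ℤ F) F) : Set F))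
        = Submodule.span ↥B {x}) ↔
      Algebra.adjoin ℤ ((algebraMap F K '' (integralClosure ℤ F : Set F)) ∪
        {z : K | z ∈ integralClosure ℤ K ∧ σ z = η * z}) ≤ B := by
  have hpos : 0 < 2 ^ n := by positivity
  have hη0 : η ≠ 0 := hη.ne_zero hpos.ne'
  have hηO : η ∈ integralClosure ℤ K := mem_integralClosure_of_pow_eq_one hpos hη.pow_eq_one
  have hση : σ η = η⁻¹ := apply_eq_inv_of_pow_eq_one hconj hpos hη.pow_eq_one
  constructor
  · rintro ⟨x, hx0, hx⟩
    obtain ⟨y, hy0, hy, hyB⟩ := exists_generator_eigenvector hconj hσσ hfix hnp hη hn hBO hB hx0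
      ((span_image_eq_span_singleton_iff a B hB hx0).mp hx)
    rw [Algebra.adjoin_le_iff]
    rintro z (⟨f, hf, rfl⟩ | ⟨hzO, hz⟩)
    · exact hB f hf
    · obtain ⟨q, hq, rfl⟩ :=
        exists_mem_inv_of_mem_eigenspace hfix hη0 hy0 hy (hyB.mono hBO) hzO hz
      exact hyB.2 q hq
  · intro hle
    refine ⟨L, hL0, (span_image_eq_span_singleton_iff a B hB hL0).mpr
      ⟨fun p hp => ?_, fun q hq => ?_⟩⟩
    · have hw : η⁻¹ * (algebraMap F K p / L) ∈ B := by
        refine hle (Algebra.subset_adjoin (Or.inr ⟨mul_mem ?_ (hgen.1 p hp), ?_⟩))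
        · exact hση ▸ σ.apply_mem_integralClosure hηO
        · rw [map_mul, map_inv₀, hση, map_div₀, AlgEquiv.commutes, hL]
          field_simp
      have h := mul_mem (hle (unit_mem_adjoin_eigenspace σ hfix hη0 hηO hση).1) hw
      rwa [mul_inv_cancel_left₀ hη0] at h
    · refine hle (Algebra.subset_adjoin (Or.inr ⟨hgen.2 q hq, ?_⟩))
      rw [map_mul, AlgEquiv.commutes, hL]
      ring

end ComplexConjugation

theorem capitulating_orders_contain_B0
    {F : Type*} [Field F] [NumberField F] (hF : TotReal F)
    {K : Type*} [Field K] [NumberField K] [Algebra F K]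
    (hquad : Module.finrank F K = 2) (hCM : IsEmpty (K →+* ℝ))
    -- the nontrivial `F`-automorphism (complex conjugation) of `K`
    (σ : K ≃ₐ[F] K) (hσ : σ ≠ AlgEquiv.refl)
    -- the unique nontrivial class `[a] ∈ ker (i_{K/F})`, with `a O_K = λ O_K`
    (a : (Submodule ↥(integralClosure ℤ F) F)ˣ)
    (hnp : ¬ ∃ x : F, x ≠ 0 ∧ (a : Submodule ↥(integralClosure ℤ F) F)
      = Submodule.span ↥(integralClosure ℤ F) {x})
    (lam : K) (hlam : lam ≠ 0)
    (hext : Submodule.span ↥(integralClosure ℤ K)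
        (algebraMap F K '' ((a : Submodule ↥(integralClosure ℤ F) F) : Set F))
      = Submodule.span ↥(integralClosure ℤ K) {lam}) :
    -- (i)  the case `K ≠ F(√−1)`
    ((¬ ∃ t : K, t ^ 2 = -1) →
      -- `B₀ := O_F ⊕ I` is an order with the indicated carrier ...
      (IsZOrder (Algebra.adjoin ℤ
          ((algebraMap F K '' (integralClosure ℤ F : Set F)) ∪
            {z : K | z ∈ integralClosure ℤ K ∧ σ z = -z})) ∧
        ((Algebra.adjoin ℤ
          ((algebraMap F K '' (integralClosure ℤ F : Set F)) ∪
            {z : K | z ∈ integralClosure ℤ K ∧ σ z = -z}) : Set K)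
          = {x : K | ∃ f ∈ integralClosure ℤ F,
              ∃ z ∈ {z : K | z ∈ integralClosure ℤ K ∧ σ z = -z},
                x = algebraMap F K f + z}) ∧
      -- ... and for every `O_F`-order `B ⊆ O_K`:  `[a] ∈ ker (i_{B/O_F})  ↔  B₀ ⊆ B`
      (∀ B : Subalgebra ℤ K, IsZOrder B → B ≤ integralClosure ℤ K →
        (∀ f : F, f ∈ integralClosure ℤ F → algebraMap F K f ∈ B) →
        ((∃ x : K, x ≠ 0 ∧
            Submodule.span ↥B
              (algebraMap F K '' ((a : Submodule ↥(integralClosure ℤ F) F) : Set F))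
              = Submodule.span ↥B {x}) ↔
          Algebra.adjoin ℤ
            ((algebraMap F K '' (integralClosure ℤ F : Set F)) ∪
              {z : K | z ∈ integralClosure ℤ K ∧ σ z = -z}) ≤ B)))) ∧
    -- (ii)  the case `K = F(√−1)`
    ((∃ t : K, t ^ 2 = -1) →
      ∀ (n : ℕ) (η : K), IsPrimitiveRoot η (2 ^ n) →
        (¬ ∃ ξ : K, IsPrimitiveRoot ξ (2 ^ (n + 1))) →
        (IsZOrder (Algebra.adjoin ℤ
            ((algebraMap F K '' (integralClosure ℤ F : Set F)) ∪
              {z : K | z ∈ integralClosure ℤ K ∧ σ z = η * z})) ∧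
          ((Algebra.adjoin ℤ
            ((algebraMap F K '' (integralClosure ℤ F : Set F)) ∪
              {z : K | z ∈ integralClosure ℤ K ∧ σ z = η * z}) : Set K)
            = {x : K | ∃ f ∈ integralClosure ℤ F,
                ∃ z ∈ {z : K | z ∈ integralClosure ℤ K ∧ σ z = η * z},
                  x = algebraMap F K f + z})) ∧
        (∀ B : Subalgebra ℤ K, IsZOrder B → B ≤ integralClosure ℤ K →
          (∀ f : F, f ∈ integralClosure ℤ F → algebraMap F K f ∈ B) →
          ((∃ x : K, x ≠ 0 ∧
              Submodule.span ↥B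
                (algebraMap F K '' ((a : Submodule ↥(integralClosure ℤ F) F) : Set F))
                = Submodule.span ↥B {x}) ↔
            Algebra.adjoin ℤ
              ((algebraMap F K '' (integralClosure ℤ F : Set F)) ∪
                {z : K | z ∈ integralClosure ℤ K ∧ σ z = η * z}) ≤ B)) ∧
        -- `η ∈ B₀ˣ`
        (η ∈ Algebra.adjoin ℤ
            ((algebraMap F K '' (integralClosure ℤ F : Set F)) ∪
              {z : K | z ∈ integralClosure ℤ K ∧ σ z = η * z}) ∧
          η⁻¹ ∈ Algebra.adjoin ℤ
            ((algebraMap F K '' (integralClosure ℤ F : Set F)) ∪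
              {z : K | z ∈ integralClosure ℤ K ∧ σ z = η * z})) ∧
        -- hence `B₀` does not depend on the choice of `η`
        (∀ η' : K, IsPrimitiveRoot η' (2 ^ n) →
          Algebra.adjoin ℤ
              ((algebraMap F K '' (integralClosure ℤ F : Set F)) ∪
                {z : K | z ∈ integralClosure ℤ K ∧ σ z = η' * z})
            = Algebra.adjoin ℤ
              ((algebraMap F K '' (integralClosure ℤ F : Set F)) ∪
                {z : K | z ∈ integralClosure ℤ K ∧ σ z = η * z}))) := by
  have hfix : ∀ z : K, σ z = z → ∃ f : F, algebraMap F K f = z := fun z hz =>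
    exists_algebraMap_eq_of_apply_eq hquad σ hσ hz
  have hconj := embedding_apply_eq_conj hF hquad hCM σ hσ
  have hσσ : ∀ z, σ (σ z) = z := by
    intro z
    obtain ⟨φ⟩ : Nonempty (K →+* ℂ) := inferInstance
    apply φ.injective
    rw [hconj, hconj, Complex.conj_conj]
  have hOF : ∀ f : F, f ∈ integralClosure ℤ F → algebraMap F K f ∈ integralClosure ℤ K :=
    fun f hf => algebraMap_mem_integralClosure_iff.mpr hf
  have hlamgen : GeneratesExtension a (integralClosure ℤ K) lam :=
    (span_image_eq_span_singleton_iff a _ hOF hlam).mp hext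
  refine ⟨fun hi => ?_, fun _ n η hη hn => ?_⟩
  · have hη : IsPrimitiveRoot (-1 : K) (2 ^ 1) := by
      simpa using IsPrimitiveRoot.neg_one 0 (by norm_num)
    have hn : ¬ ∃ ξ : K, IsPrimitiveRoot ξ (2 ^ (1 + 1)) := by
      rintro ⟨ξ, hξ⟩
      have h2 : IsPrimitiveRoot (ξ ^ 2) 2 := hξ.pow (by norm_num) (by norm_num)
      exact hi ⟨ξ, h2.eq_neg_one_of_two_right⟩
    have hO : (-1 : K) ∈ integralClosure ℤ K := neg_mem (one_mem _)
    have hσ1 : σ (-1) = (-1)⁻¹ := by simp [inv_neg]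
    obtain ⟨L, hL0, hL, hLgen⟩ := exists_generator_eigenvector hconj hσσ hfix hnp hη hn le_rfl
      hOF hlam hlamgen
    have hne : (-1 : K) ≠ 1 := by norm_num
    have hne0 : (-1 : K) ≠ 0 := by norm_num
    have h1 := isZOrder_adjoin_eigenspace σ hσσ hfix hne0 hne hσ1 hL0 hL
    have h2 := coe_adjoin_eigenspace σ hfix hne0 hO hσ1
    have h3 := fun (B : Subalgebra ℤ K) hBO hB =>
      exists_generator_iff_adjoin_eigenspace_le hconj hσσ hfix hnp hη hn hL0 hL hLgen
        (B := B) hBO hB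
    simp only [neg_one_mul] at h1 h2 h3
    exact ⟨h1, h2, fun B _ hBO hB => h3 B hBO hB⟩
  · have hpos : 0 < 2 ^ n := by positivity
    have hη0 : η ≠ 0 := hη.ne_zero hpos.ne'
    have hO : η ∈ integralClosure ℤ K := mem_integralClosure_of_pow_eq_one hpos hη.pow_eq_one
    have hση : σ η = η⁻¹ := apply_eq_inv_of_pow_eq_one hconj hpos hη.pow_eq_one
    have hn0 : n ≠ 0 := by
      rintro rfl
      exact hn ⟨-1, by simpa using IsPrimitiveRoot.neg_one 0 (by norm_num)⟩
    have hη1 : η ≠ 1 := hη.ne_one (Nat.one_lt_two_pow hn0)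
    obtain ⟨L, hL0, hL, hLgen⟩ := exists_generator_eigenvector hconj hσσ hfix hnp hη hn le_rfl
      hOF hlam hlamgen
    have hle : ∀ α β : K, IsPrimitiveRoot α (2 ^ n) → IsPrimitiveRoot β (2 ^ n) →
        Algebra.adjoin ℤ ((algebraMap F K '' (integralClosure ℤ F : Set F)) ∪
            {z : K | z ∈ integralClosure ℤ K ∧ σ z = β * z}) ≤
          Algebra.adjoin ℤ ((algebraMap F K '' (integralClosure ℤ F : Set F)) ∪
            {z : K | z ∈ integralClosure ℤ K ∧ σ z = α * z}) := by
      intro α β hα hβ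
      obtain ⟨j, -, hj⟩ := hα.eq_pow_of_pow_eq_one hβ.pow_eq_one
      have hcop : j.Coprime (2 ^ n) := (hα.pow_iff_coprime hpos j).mp (hj ▸ hβ)
      obtain ⟨s, hs⟩ : Odd j :=
        Nat.coprime_two_right.mp ((Nat.coprime_pow_right_iff (Nat.pos_of_ne_zero hn0) _ _).mp hcop)
      rw [← hj, hs]
      exact adjoin_eigenspace_mul_sq_le σ hfix (hα.ne_zero hpos.ne')
        (mem_integralClosure_of_pow_eq_one hpos hα.pow_eq_one)
        (apply_eq_inv_of_pow_eq_one hconj hpos hα.pow_eq_one) s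
    exact ⟨⟨isZOrder_adjoin_eigenspace σ hσσ hfix hη0 hη1 hση hL0 hL,
        coe_adjoin_eigenspace σ hfix hη0 hO hση⟩,
      fun B _ hBO hB => exists_generator_iff_adjoin_eigenspace_le hconj hσσ hfix hnp hη hn hL0 hL
        hLgen hBO hB,
      unit_mem_adjoin_eigenspace σ hfix hη0 hO hση,
      fun η' hη' => le_antisymm (hle η η' hη hη') (hle η' η hη' hη)⟩

end
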